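/- arXiv:2604.27334 — 6 statements merged into one kernel-verified Lean document; each statement's English description precedes it below -/
import Mathlib

section
/- Let a and b be non-negative integers and let (A_1,B_1),...,(A_m,B_m) be a skew Bollobás system (over some finite ground set) such that |A_i| ≤ a and |B_i| ≤ b for every i ∈ {1,...,m}. Then m ≤ C(a+b, a), where C denotes the binomial coefficient. -/
/-- A skew Bollobás system: pairs `(A i, B i)` of finite sets with `A i ∩ B i = ∅`
and `A i ∩ B j ≠ ∅` whenever `i < j`. -/
def IsSkewBollobasSystem (m : ℕ) (A B : Fin m → Finset ℕ) : Prop :=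
  (∀ i, Disjoint (A i) (B i)) ∧ (∀ i j : Fin m, i < j → (A i ∩ B j).Nonempty)

/-- Homogeneous polynomials of degree `n` that are triangular with respect to a family of points
are at most as many as the monomials of degree `n`. -/
theorem MvPolynomial.card_le_multichoose_of_eval_triangular {σ K : Type*} [Fintype σ] [Field K]
    {m n : ℕ} (f : Fin m → MvPolynomial σ K) (w : Fin m → σ → K)
    (hf : ∀ j, (f j).IsHomogeneous n)
    (hzero : ∀ i j, i < j → MvPolynomial.eval (w i) (f j) = 0)
    (hne : ∀ i, MvPolynomial.eval (w i) (f i) ≠ 0) :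
    m ≤ (Fintype.card σ).multichoose n := by
  classical
  let S : Finset (σ →₀ ℕ) := Finset.univ.finsuppAntidiag n
  let W : Matrix (Fin m) S K := fun i d ↦ ∏ k, w i k ^ (d : σ →₀ ℕ) k
  let F : Matrix S (Fin m) K := fun d j ↦ (f j).coeff d
  have hWF : ∀ i j, (W * F) i j = MvPolynomial.eval (w i) (f j) := by
    intro i j
    have hsupp : (f j).support ⊆ S := by
      intro d hd
      have hdeg : d.degree = n := by
        by_contra h
        exact MvPolynomial.mem_support_iff.mp hd ((hf j).coeff_eq_zero h)
      simp [S, Finset.mem_finsuppAntidiag, ← hdeg, Finsupp.degree_eq_sum]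
    rw [MvPolynomial.eval_eq', Finset.sum_subset hsupp, ← Finset.sum_coe_sort S]
    · rw [Matrix.mul_apply]
      exact Finset.sum_congr rfl fun d _ ↦ mul_comm _ _
    · intro d _ hd
      rw [MvPolynomial.notMem_support_iff.mp hd, zero_mul]
  have hdet : (W * F).det ≠ 0 := by
    rw [Matrix.det_of_isLowerTriangular (W * F) fun i j hij ↦ by
      rw [hWF]; exact hzero i j hij]
    exact Finset.prod_ne_zero_iff.mpr fun i _ ↦ by rw [hWF]; exact hne i
  calc m = (W * F).rank := by
        rw [Matrix.rank_of_isUnit _ ((Matrix.isUnit_iff_isUnit_det _).mpr hdet.isUnit),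
          Fintype.card_fin]
    _ ≤ W.rank := Matrix.rank_mul_le_left W F
    _ ≤ Fintype.card S := Matrix.rank_le_card_width W
    _ = (Fintype.card σ).multichoose n := by
        simp [S, Finset.card_finsuppAntidiag_nat_eq_multichoose]

/-- Every finite set of naturals of size at most `a` is the set of natural roots of a monic
rational polynomial of degree `a`. -/
theorem Finset.exists_monic_natDegree_eq_eval_natCast_eq_zero_iff {a : ℕ} (s : Finset ℕ)
    (hs : s.card ≤ a) :
    ∃ p : Polynomial ℚ, p.Monic ∧ p.natDegree = a ∧ ∀ y : ℕ, p.eval (y : ℚ) = 0 ↔ y ∈ s := by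
  have hprod : (∏ x ∈ s, (Polynomial.X - Polynomial.C (x : ℚ))).Monic :=
    Polynomial.monic_prod_of_monic _ _ fun x _ ↦ Polynomial.monic_X_sub_C _
  have hpow : ((Polynomial.X + Polynomial.C (1 : ℚ)) ^ (a - s.card)).Monic :=
    (Polynomial.monic_X_add_C 1).pow _
  refine ⟨_, hprod.mul hpow, ?_, fun y ↦ ?_⟩
  · rw [hprod.natDegree_mul hpow, Polynomial.natDegree_finsetProd_X_sub_C_eq_card,
      Polynomial.natDegree_pow, Polynomial.natDegree_X_add_C, mul_one, Nat.add_sub_cancel' hs]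
  · have hy : (y : ℚ) + 1 ≠ 0 := by positivity
    simp [Polynomial.eval_prod, Finset.prod_eq_zero_iff, sub_eq_zero, hy]

/-- Theorem (Frankl, Kalai): a skew Bollobás system with `|A i| ≤ a` and `|B i| ≤ b`
has at most `C(a+b, a)` pairs. -/
theorem skew_bollobas_card_le (a b m : ℕ) (A B : Fin m → Finset ℕ)
    (hsys : IsSkewBollobasSystem m A B)
    (hA : ∀ i, (A i).card ≤ a) (hB : ∀ i, (B i).card ≤ b) :
    m ≤ (a + b).choose a := by
  choose p hmonic hdeg hroot using
    fun i ↦ (A i).exists_monic_natDegree_eq_eval_natCast_eq_zero_iff (hA i)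
  let L (y : ℕ) : MvPolynomial (Fin (a + 1)) ℚ :=
    ∑ k : Fin (a + 1), MvPolynomial.C ((y : ℚ) ^ (k : ℕ)) * MvPolynomial.X k
  let f (j : Fin m) : MvPolynomial (Fin (a + 1)) ℚ :=
    (∏ y ∈ B j, L y) * MvPolynomial.X (Fin.last a) ^ (b - (B j).card)
  let w (i : Fin m) (k : Fin (a + 1)) : ℚ := (p i).coeff k
  have hL : ∀ i y, MvPolynomial.eval (w i) (L y) = (p i).eval (y : ℚ) := by
    intro i y
    rw [Polynomial.eval_eq_sum_range, hdeg, Finset.sum_range]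
    simp [L, w, mul_comm]
  have hlead : ∀ i, w i (Fin.last a) = 1 := fun i ↦ by
    simpa [w, hdeg i] using (hmonic i).coeff_natDegree
  have heval : ∀ i j, MvPolynomial.eval (w i) (f j) = ∏ y ∈ B j, (p i).eval (y : ℚ) := by
    intro i j
    simp [f, hL, hlead]
  have hhom : ∀ j, (f j).IsHomogeneous b := by
    intro j
    have hprod : (∏ y ∈ B j, L y).IsHomogeneous (∑ _y ∈ B j, 1) :=
      MvPolynomial.IsHomogeneous.prod _ _ _ fun y _ ↦
        MvPolynomial.IsHomogeneous.sum _ _ _ fun k _ ↦ MvPolynomial.isHomogeneous_C_mul_X _ k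
    have h := hprod.mul (MvPolynomial.isHomogeneous_X_pow (R := ℚ) (Fin.last a) (b - (B j).card))
    rwa [← Finset.card_eq_sum_ones, Nat.add_sub_cancel' (hB j)] at h
  have hle := MvPolynomial.card_le_multichoose_of_eval_triangular f w hhom
    (fun i j hij ↦ by
      obtain ⟨y, hy⟩ := hsys.2 i j hij
      rw [Finset.mem_inter] at hy
      rw [heval]
      exact Finset.prod_eq_zero hy.2 ((hroot i y).mpr hy.1))
    (fun i ↦ by
      rw [heval]
      exact Finset.prod_ne_zero_iff.mpr fun y hy h ↦
        Finset.disjoint_left.mp (hsys.1 i) ((hroot i y).mp h) hy)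
  rw [Fintype.card_fin, Nat.multichoose_eq] at hle
  rwa [Nat.choose_symm_add, show a + b = a + 1 + b - 1 by omega]
end

section
/- Let a and b be non-negative integers. The number C(a+b+1, a) − 1 is the greatest element of the set of all natural numbers n for which there exists a skew Bollobás system (A_1,B_1),...,(A_m,B_m) with |A_i| ≤ a and |B_i| ≤ b for every i ∈ {1,...,m} and |A_1 ∪ ... ∪ A_m| = n. In other words, S_1(a,b) = C(a+b+1, a) − 1. -/
/-- A subset of the union of a finite family is covered by a subfamily in which every member
has a private element of that subset. -/
theorem exists_subcover_private {ι α : Type*} [DecidableEq ι] [DecidableEq α]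
    [Nonempty α] (A : ι → Finset α) (I : Finset ι) (U : Finset α) (hU : U ⊆ I.biUnion A) :
    ∃ J ⊆ I, U ⊆ J.biUnion A ∧
      ∃ y : ι → α, ∀ i ∈ J, y i ∈ U ∧ y i ∈ A i ∧ ∀ j ∈ J, y i ∈ A j → j = i := by
  classical
  induction I using Finset.strongInduction with
  | H I ih =>
    by_cases h : ∃ i ∈ I, U ⊆ (I.erase i).biUnion A
    · obtain ⟨i, hi, hUi⟩ := h
      obtain ⟨J, hJ, h⟩ := ih _ (Finset.erase_ssubset hi) hUi
      exact ⟨J, hJ.trans (Finset.erase_subset _ _), h⟩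
    · push Not at h
      refine ⟨I, subset_rfl, hU, ?_⟩
      have key : ∀ i, ∃ x, i ∈ I → x ∈ U ∧ x ∈ A i ∧ ∀ j ∈ I, x ∈ A j → j = i := by
        intro i
        by_cases hi : i ∈ I
        · obtain ⟨x, hxU, hx⟩ := Finset.not_subset.mp (h i hi)
          have hpriv : ∀ j ∈ I, x ∈ A j → j = i := fun j hj hxj => by
            by_contra hne
            exact hx (Finset.mem_biUnion.mpr ⟨j, Finset.mem_erase.mpr ⟨hne, hj⟩, hxj⟩)
          obtain ⟨j, hj, hxj⟩ := Finset.mem_biUnion.mp (hU hxU)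
          exact ⟨x, fun _ => ⟨hxU, hpriv j hj hxj ▸ hxj, hpriv⟩⟩
        · exact ⟨Classical.arbitrary α, fun h => absurd h hi⟩
      choose y hy using key
      exact ⟨y, hy⟩

/-- The multiset of values of a tuple. -/
def symOfTuple {α : Type*} {a : ℕ} (p : Fin a → α) : Sym α a :=
  ⟨Finset.univ.val.map p, by simp⟩

/-- A product of `a` linear forms in `b + 1` variables, grouped by monomials. -/
theorem prod_sum_eq_sum_sym {R : Type*} [CommRing R] (a b : ℕ) (c : Fin (b + 1) → R)
    (g : Fin a → Fin (b + 1) → R) :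
    ∏ k, ∑ l, g k l * c l =
      ∑ s : Sym (Fin (b + 1)) a,
        (∑ p : Fin a → Fin (b + 1) with symOfTuple p = s, ∏ k, g k (p k)) *
        ((s : Multiset (Fin (b + 1))).map c).prod := by
  classical
  rw [Finset.prod_univ_sum, Fintype.piFinset_univ,
    ← Finset.sum_fiberwise (s := Finset.univ)
      (g := symOfTuple)]
  refine Finset.sum_congr rfl fun s _ => ?_
  rw [Finset.sum_mul]
  refine Finset.sum_congr rfl fun p hp => ?_
  obtain rfl := (Finset.mem_filter.mp hp).2
  rw [Finset.prod_mul_distrib]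
  simp [symOfTuple, Finset.prod, Function.comp_def]

/-- A finite set of size at most `a` missing `N` is listed by `a` slots, up to repeats of `N`. -/
theorem exists_listing (S : Finset ℕ) (a N : ℕ) (hS : S.card ≤ a) :
    ∃ g : Fin a → ℕ, (∀ k, g k ∈ S ∨ g k = N) ∧ ∀ x ∈ S, ∃ k, g k = x := by
  refine ⟨fun k => S.toList.getD k N, fun k => ?_, fun x hx => ?_⟩
  · by_cases hk : (k : ℕ) < S.toList.length
    · left
      dsimp only
      rw [List.getD_eq_getElem _ _ hk]
      exact Finset.mem_toList.mp (List.getElem_mem hk)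
    · right
      exact List.getD_eq_default _ _ (not_lt.mp hk)
  · obtain ⟨n, hn, rfl⟩ := List.mem_iff_getElem.mp (Finset.mem_toList.mpr hx)
    exact ⟨⟨n, by rw [Finset.length_toList] at hn; omega⟩, List.getD_eq_getElem _ _ hn⟩

/-- The skew Bollobás theorem. -/
theorem card_le_choose_of_skew {ι : Type*} [Fintype ι] [LinearOrder ι] (a b : ℕ)
    (A B : ι → Finset ℕ) (hd : ∀ i, Disjoint (A i) (B i))
    (hc : ∀ i j, i < j → (A i ∩ B j).Nonempty)
    (hA : ∀ i, (A i).card ≤ a) (hB : ∀ i, (B i).card ≤ b) :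
    Fintype.card ι ≤ (a + b).choose a := by
  classical
  obtain ⟨N, hN⟩ : ∃ N, N ∉ Finset.univ.biUnion B := Infinite.exists_notMem_finset _
  have hN' : ∀ i, N ∉ B i := fun i h => hN (Finset.mem_biUnion.mpr ⟨i, Finset.mem_univ _, h⟩)
  choose g hg hg' using fun i => exists_listing (A i) a N (hA i)
  let q : ι → Polynomial ℚ := fun j => ∏ y ∈ B j, (Polynomial.X - Polynomial.C (y : ℚ))
  have hdeg : ∀ j, (q j).natDegree < b + 1 := fun j => by
    simp only [q, Polynomial.natDegree_finsetProd_X_sub_C_eq_card]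
    exact Nat.lt_succ_of_le (hB j)
  have hq : ∀ j (x : ℕ), (q j).eval (x : ℚ) = 0 ↔ x ∈ B j := fun j x => by
    simp [q, Polynomial.eval_prod, Finset.prod_eq_zero_iff, sub_eq_zero]
  let M : Matrix ι ι ℚ := fun i j => ∏ k, (q j).eval (g i k : ℚ)
  let W : Matrix (Sym (Fin (b + 1)) a) ι ℚ := fun s j =>
    ((s : Multiset (Fin (b + 1))).map fun l : Fin (b + 1) => (q j).coeff l).prod
  let G : Matrix ι (Sym (Fin (b + 1)) a) ℚ := fun i s =>
    ∑ p : Fin a → Fin (b + 1) with symOfTuple p = s, ∏ k, (g i k : ℚ) ^ (p k : ℕ)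
  have hM : M = G * W := by
    ext i j
    rw [Matrix.mul_apply]
    refine Eq.trans ?_ (prod_sum_eq_sum_sym a b (fun l => (q j).coeff l)
      fun k l => (g i k : ℚ) ^ (l : ℕ))
    refine Finset.prod_congr rfl fun k _ => ?_
    rw [Polynomial.eval_eq_sum_range' (hdeg j), ← Fin.sum_univ_eq_sum_range
      (fun l => (q j).coeff l * (g i k : ℚ) ^ l)]
    exact Finset.sum_congr rfl fun l _ => mul_comm _ _
  have htri : M.BlockTriangular OrderDual.toDual := fun i j hij => by
    obtain ⟨x, hx⟩ := hc i j hij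
    rw [Finset.mem_inter] at hx
    obtain ⟨k, hk⟩ := hg' i x hx.1
    exact Finset.prod_eq_zero (Finset.mem_univ k) ((hq _ _).mpr (hk ▸ hx.2))
  have hdet : M.det ≠ 0 := by
    rw [Matrix.det_of_isLowerTriangular M htri, Finset.prod_ne_zero_iff]
    intro i _
    refine Finset.prod_ne_zero_iff.mpr fun k _ h => ?_
    rw [hq] at h
    rcases hg i k with h' | h'
    · exact Finset.disjoint_left.mp (hd i) h' h
    · exact hN' i (h' ▸ h)
  calc Fintype.card ι = M.rank :=
        (Matrix.rank_of_isUnit M ((Matrix.isUnit_iff_isUnit_det M).mpr hdet.isUnit)).symm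
    _ ≤ G.rank := hM ▸ Matrix.rank_mul_le_left G W
    _ ≤ Fintype.card (Sym (Fin (b + 1)) a) := Matrix.rank_le_card_width G
    _ = (a + b).choose a := by
        rw [Sym.card_sym_eq_choose, Fintype.card_fin]
        congr 1
        omega

/-- The upper bound, by induction on `a`: discard one private element from each member of a
minimal cover, then merge it with a private element of a minimal cover of what is left. -/
theorem card_biUnion_lt_of_skew {ι : Type*} [LinearOrder ι] (a b : ℕ) (I : Finset ι)
    (A B : ι → Finset ℕ) (hd : ∀ i ∈ I, Disjoint (A i) (B i))
    (hc : ∀ i ∈ I, ∀ j ∈ I, i < j → (A i ∩ B j).Nonempty)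
    (hA : ∀ i ∈ I, (A i).card ≤ a) (hB : ∀ i ∈ I, (B i).card ≤ b) :
    (I.biUnion A).card < (a + b + 1).choose a := by
  classical
  induction a generalizing I A B with
  | zero =>
    have : I.biUnion A = ∅ := by
      refine Finset.eq_empty_of_forall_notMem fun x hx => ?_
      obtain ⟨i, hi, hxi⟩ := Finset.mem_biUnion.mp hx
      exact Finset.card_ne_zero_of_mem hxi (Nat.le_zero.mp (hA i hi))
    simp [this]
  | succ a ih =>
    obtain ⟨J, hJI, hJU, x, hx⟩ := exists_subcover_private A I _ subset_rfl
    have hJcard : J.card ≤ (a + 1 + b).choose (a + 1) := by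
      have := card_le_choose_of_skew (ι := J) (a + 1) b (fun i => A i) (fun i => B i)
        (fun i => hd i (hJI i.2)) (fun i j hij => hc i (hJI i.2) j (hJI j.2) hij)
        (fun i => hA i (hJI i.2)) (fun i => hB i (hJI i.2))
      rwa [Fintype.card_coe] at this
    set V := I.biUnion A \ J.image x with hV
    obtain ⟨K, hKJ, hKV, y, hy⟩ := exists_subcover_private A J V
      (Finset.sdiff_subset.trans hJU)
    let φ : ℕ → ℕ := fun z => if h : ∃ i ∈ K, x i = z then y h.choose else z
    have hφx : ∀ i ∈ K, φ (x i) = y i := fun i hi => by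
      have h : ∃ k ∈ K, x k = x i := ⟨i, hi, rfl⟩
      have hk := h.choose_spec
      have : h.choose = i := by
        refine (hx i (hKJ hi)).2.2 _ (hKJ hk.1) ?_
        have h2 := (hx _ (hKJ hk.1)).2.1
        rwa [hk.2] at h2
      simp only [φ, dif_pos h, this]
    have hφ : ∀ z, (∀ i ∈ K, x i ≠ z) → φ z = z := fun z hz => by
      have h : ¬ ∃ i ∈ K, x i = z := by push Not; exact hz
      simp only [φ, dif_neg h]
    have hyx : ∀ i ∈ K, ∀ j ∈ J, y i ≠ x j := fun i hi j hj h =>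
      (Finset.mem_sdiff.mp (hy i hi).1).2 (Finset.mem_image.mpr ⟨j, hj, h.symm⟩)
    have hrec := ih K (fun i => (A i).erase (x i)) (fun i => (B i).image φ)
      (fun i hi => by
        rw [Finset.disjoint_left]
        intro w hw hw'
        obtain ⟨hwx, hwA⟩ := Finset.mem_erase.mp hw
        obtain ⟨z, hz, rfl⟩ := Finset.mem_image.mp hw'
        have hdi := Finset.disjoint_left.mp (hd i (hJI (hKJ hi)))
        by_cases hzx : ∃ k ∈ K, x k = z
        · obtain ⟨k, hk, rfl⟩ := hzx
          rw [hφx k hk] at hwA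
          obtain rfl := (hy k hk).2.2 i hi hwA
          exact hdi (hx i (hKJ hi)).2.1 hz
        · push Not at hzx
          rw [hφ z hzx] at hwA
          exact hdi hwA hz)
      (fun i hi j hj hij => by
        obtain ⟨z, hz⟩ := hc i (hJI (hKJ hi)) j (hJI (hKJ hj)) hij
        rw [Finset.mem_inter] at hz
        refine ⟨φ z, Finset.mem_inter.mpr ⟨?_, Finset.mem_image_of_mem _ hz.2⟩⟩
        by_cases hzx : x i = z
        · rw [← hzx, hφx i hi]
          exact Finset.mem_erase.mpr ⟨hyx i hi i (hKJ hi), (hy i hi).2.1⟩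
        · rw [hφ z fun k hk hkz => hzx ?_]
          · exact Finset.mem_erase.mpr ⟨fun h => hzx h.symm, hz.1⟩
          · obtain rfl := (hx k (hKJ hk)).2.2 i (hKJ hi) (hkz ▸ hz.1)
            exact hkz)
      (fun i hi => by
        rw [Finset.card_erase_of_mem (hx i (hKJ hi)).2.1]
        have := hA i (hJI (hKJ hi))
        omega)
      (fun i hi => Finset.card_image_le.trans (hB i (hJI (hKJ hi))))
    have hVcard : V.card ≤ (K.biUnion fun i => (A i).erase (x i)).card := by
      refine Finset.card_le_card fun v hv => ?_
      obtain ⟨i, hi, hvi⟩ := Finset.mem_biUnion.mp (hKV hv)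
      refine Finset.mem_biUnion.mpr ⟨i, hi, Finset.mem_erase.mpr ⟨?_, hvi⟩⟩
      rintro rfl
      exact (Finset.mem_sdiff.mp hv).2 (Finset.mem_image_of_mem _ (hKJ hi))
    have hU : (I.biUnion A).card ≤ V.card + J.card :=
      Finset.card_le_card_sdiff_add_card.trans
        (Nat.add_le_add_left Finset.card_image_le _)
    have hpascal : (a + 1 + b + 1).choose (a + 1) =
        (a + b + 1).choose a + (a + 1 + b).choose (a + 1) := by
      rw [Nat.choose_succ_succ' (a + 1 + b) a, show a + 1 + b = a + b + 1 by ring]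
    omega

/-- The lower bound: glue disjoint copies of extremal systems for `(a, b + 1)` and `(a + 1, b)`
along a new element. -/
theorem exists_skew_card_biUnion (a b : ℕ) :
    ∃ (m : ℕ) (A B : Fin m → Finset ℕ), 0 < m ∧ IsSkewBollobasSystem m A B ∧
      (∀ i, (A i).card ≤ a) ∧ (∀ i, (B i).card ≤ b) ∧
      (Finset.univ.biUnion A).card + 1 = (a + b + 1).choose a := by
  induction a generalizing b with
  | zero =>
    exact ⟨1, fun _ => ∅, fun _ => ∅, one_pos, ⟨by simp, fun i j h => by omega⟩, by simp,
      by simp, by simp⟩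
  | succ a iha =>
    induction b with
    | zero =>
      exact ⟨1, fun _ => Finset.range (a + 1), fun _ => ∅, one_pos,
        ⟨by simp, fun i j h => by omega⟩, by simp, by simp, by simp⟩
    | succ b ihb =>
      obtain ⟨m, A, B, hm, ⟨hd, hc⟩, hA, hB, hn⟩ := iha (b + 1)
      obtain ⟨m', A', B', -, ⟨hd', hc'⟩, hA', hB', hn'⟩ := ihb
      let f : ℕ ↪ ℕ := ⟨fun x => 2 * x + 1, fun x y h => by simpa using h⟩
      let g : ℕ ↪ ℕ := ⟨fun x => 2 * x + 2, fun x y h => by simpa using h⟩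
      have hf0 : ∀ S : Finset ℕ, 0 ∉ S.map f := fun S => by simp [f]
      have hg0 : ∀ S : Finset ℕ, 0 ∉ S.map g := fun S => by simp [g]
      refine ⟨m + m', Fin.append (fun i => insert 0 ((A i).map f)) (fun i => (A' i).map g),
        Fin.append (fun i => (B i).map f) (fun i => insert 0 ((B' i).map g)),
        by omega, ⟨fun i => ?_, fun i j => ?_⟩, fun i => ?_, fun i => ?_, ?_⟩
      · refine Fin.addCases (fun i => ?_) (fun i => ?_) i
        · simpa [hf0] using hd i
        · simpa [hg0] using hd' i
      · refine Fin.addCases (fun i => ?_) (fun i => ?_) i <;>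
          refine Fin.addCases (fun j => ?_) (fun j => ?_) j <;> intro hij
        · obtain ⟨x, hx⟩ := hc i j hij
          rw [Finset.mem_inter] at hx
          refine ⟨f x, ?_⟩
          simp [hx.1, hx.2]
        · exact ⟨0, by simp⟩
        · simp only [Fin.lt_def, Fin.val_natAdd, Fin.val_castAdd] at hij
          omega
        · obtain ⟨x, hx⟩ := hc' i j (Nat.lt_of_add_lt_add_left hij)
          rw [Finset.mem_inter] at hx
          refine ⟨g x, ?_⟩
          simp [hx.1, hx.2]
      · refine Fin.addCases (fun i => ?_) (fun i => ?_) i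
        · simpa [hf0] using hA i
        · simpa using hA' i
      · refine Fin.addCases (fun i => ?_) (fun i => ?_) i
        · simpa using hB i
        · simpa [hg0] using hB' i
      · have hU : Finset.univ.biUnion
            (Fin.append (fun i => insert 0 ((A i).map f)) (fun i => (A' i).map g)) =
            insert 0 ((Finset.univ.biUnion A).map f ∪ (Finset.univ.biUnion A').map g) := by
          have hex (p : Fin (m + m') → Prop) : (∃ i, p i) ↔
              (∃ i, p (Fin.castAdd m' i)) ∨ ∃ i, p (Fin.natAdd m i) :=
            ⟨fun ⟨i, hi⟩ => by
              induction i using Fin.addCases with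
              | left i => exact Or.inl ⟨i, hi⟩
              | right i => exact Or.inr ⟨i, hi⟩,
            fun h => h.elim (fun ⟨i, hi⟩ => ⟨_, hi⟩) fun ⟨i, hi⟩ => ⟨_, hi⟩⟩
          ext x
          simp only [Finset.mem_biUnion, Finset.mem_univ, true_and, Finset.mem_insert,
            Finset.mem_union, Finset.mem_map, hex, Fin.append_left,
            Fin.append_right]
          constructor
          · rintro (⟨i, rfl | ⟨y, hy, rfl⟩⟩ | ⟨i, y, hy, rfl⟩)
            · exact Or.inl rfl
            · exact Or.inr (Or.inl ⟨y, ⟨i, hy⟩, rfl⟩)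
            · exact Or.inr (Or.inr ⟨y, ⟨i, hy⟩, rfl⟩)
          · rintro (rfl | ⟨y, ⟨i, hy⟩, rfl⟩ | ⟨y, ⟨i, hy⟩, rfl⟩)
            · exact Or.inl ⟨⟨0, hm⟩, Or.inl rfl⟩
            · exact Or.inl ⟨i, Or.inr ⟨y, hy, rfl⟩⟩
            · exact Or.inr ⟨i, y, hy, rfl⟩
        have hdisj : Disjoint ((Finset.univ.biUnion A).map f)
            ((Finset.univ.biUnion A').map g) := by
          rw [Finset.disjoint_left]
          intro x hx hx'
          obtain ⟨y, -, rfl⟩ := Finset.mem_map.mp hx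
          obtain ⟨z, -, hz⟩ := Finset.mem_map.mp hx'
          replace hz : 2 * z + 2 = 2 * y + 1 := hz
          omega
        rw [hU, Finset.card_insert_of_notMem (by
            rw [Finset.mem_union]; exact not_or.mpr ⟨hf0 _, hg0 _⟩),
          Finset.card_union_of_disjoint hdisj, Finset.card_map, Finset.card_map,
          Nat.choose_succ_succ' (a + 1 + (b + 1)) a]
        rw [show a + (b + 1) + 1 = a + 1 + (b + 1) by ring] at hn
        rw [show a + 1 + b + 1 = a + 1 + (b + 1) by ring] at hn'
        omega

/-- `S₁(a,b) = C(a+b+1, a) - 1`: the number `C(a+b+1, a) - 1` is the greatest size of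
`A 1 ∪ ⋯ ∪ A m` over all skew Bollobás systems with `|A i| ≤ a`, `|B i| ≤ b`. -/
theorem S1_eq (a b : ℕ) :
    IsGreatest {n : ℕ | ∃ (m : ℕ) (A B : Fin m → Finset ℕ),
        IsSkewBollobasSystem m A B ∧ (∀ i, (A i).card ≤ a) ∧ (∀ i, (B i).card ≤ b) ∧
        (Finset.univ.biUnion A).card = n}
      ((a + b + 1).choose a - 1) := by
  constructor
  · obtain ⟨m, A, B, -, h, hA, hB, hn⟩ := exists_skew_card_biUnion a b
    exact ⟨m, A, B, h, hA, hB, by omega⟩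
  · rintro n ⟨m, A, B, ⟨hd, hc⟩, hA, hB, rfl⟩
    exact Nat.le_sub_one_of_lt (card_biUnion_lt_of_skew a b Finset.univ A B
      (fun i _ => hd i) (fun i _ j _ h => hc i j h) (fun i _ => hA i) (fun i _ => hB i))
end

section
/- Let a and b be non-negative integers. The number C(a+b+1, a+1) − 1 is the greatest element of the set of all natural numbers n for which there exists a skew Bollobás system (A_1,B_1),...,(A_m,B_m) with |A_i| ≤ a and |B_i| ≤ b for every i ∈ {1,...,m} and |B_1 ∪ ... ∪ B_m| = n. In other words, S_2(a,b) = C(a+b+1, a+1) − 1. -/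
section Auxiliary

open Finset Filter Topology

/-- A nonsingular matrix whose `j`-th column evaluates a product of `d` linear forms in `n`
variables has size at most the number of monomials of degree `d` in `n` variables. -/
theorem card_le_of_det_prod_sum_ne_zero {m n d : ℕ} (q : Fin m → Fin n → ℝ)
    (l : Fin m → Fin d → Fin n → ℝ)
    (h : (Matrix.of fun i j => ∏ r, ∑ k, q i k * l j r k).det ≠ 0) :
    m ≤ (n + d - 1).choose d := by
  classical
  let toSym (φ : Fin d → Fin n) : Sym (Fin n) d := ⟨univ.val.map φ, by simp⟩
  let V : Matrix (Fin m) (Sym (Fin n) d) ℝ := .of fun i σ => (σ.1.map (q i)).prod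
  let W : Matrix (Sym (Fin n) d) (Fin m) ℝ :=
    .of fun σ j => ∑ φ with toSym φ = σ, ∏ r, l j r (φ r)
  have hVW : (Matrix.of fun i j => ∏ r, ∑ k, q i k * l j r k) = V * W := by
    ext i j
    simp only [Matrix.of_apply, Matrix.mul_apply, V, W, Finset.prod_univ_sum,
      Fintype.piFinset_univ, Finset.mul_sum]
    rw [← Finset.sum_fiberwise univ toSym]
    refine Finset.sum_congr rfl fun σ _ => Finset.sum_congr rfl fun φ hφ => ?_
    rw [Finset.mem_filter] at hφ
    rw [Finset.prod_mul_distrib, ← hφ.2]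
    congr 1
    simp only [toSym, Multiset.map_map]
    rfl
  have hr := Matrix.rank_of_isUnit _ ((Matrix.isUnit_iff_isUnit_det _).2 h.isUnit)
  rw [Fintype.card_fin, hVW] at hr
  calc m = (V * W).rank := hr.symm
    _ ≤ V.rank := Matrix.rank_mul_le_left _ _
    _ ≤ Fintype.card (Sym (Fin n) d) := Matrix.rank_le_card_width _
    _ = _ := by rw [Sym.card_sym_eq_choose, Fintype.card_fin]

/-- Real points `t` can be chosen so that the points in `N j` are close to a common point `s j`,
on a scale much finer than those of the earlier `N i`; the matrix is then nonsingular, as it is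
lower triangular up to terms that vanish in the limit. -/
theorem exists_points_det_ne_zero : ∀ (m : ℕ) (A O N : Fin m → Finset ℕ) (X : Finset ℕ)
    (t₀ : ℕ → ℝ), (∀ i, A i ⊆ X) → (∀ i, N i ⊆ X) → (∀ i, Disjoint (A i) (O i)) →
    (∀ i, Disjoint (A i) (N i)) → (∀ i, (N i).Nonempty) → (∀ i j, i < j → (A i ∩ (O j ∪ N j)).Nonempty) →
    (∀ j, ∀ y ∈ O j, ∃ i < j, y ∈ N i) → (∀ i j, i < j → Disjoint (N i) (N j)) →
    ∃ (t : ℕ → ℝ) (s : Fin m → ℝ), (∀ y, (∀ i, y ∉ N i) → t y = t₀ y) ∧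
      (∀ i, ∀ y ∈ N i, ∀ x ∈ X, x ≠ y → t y ≠ t x) ∧
      (Matrix.of fun i j => (∏ x ∈ A i, (s j - t x)) *
        ∏ y ∈ O j, ∏ x ∈ A i, (t y - t x)).det ≠ 0 := by
  intro m
  induction m with
  | zero =>
    intro A O N X t₀ _ _ _ _ _ _ _ _
    exact ⟨t₀, Fin.elim0, fun _ _ => rfl, fun i => i.elim0, by simp⟩
  | succ m ih =>
    intro A O N X t₀ hA hN hAO hAN hNe hskew hO hNN
    obtain ⟨c, hc⟩ := Infinite.exists_notMem_finset (X.image t₀)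
    obtain ⟨t, s, ht₀, hne, hdet⟩ := ih (fun i => A i.castSucc) (fun i => O i.castSucc)
      (fun i => N i.castSucc) X (fun z => if z ∈ N (Fin.last m) then c else t₀ z)
      (fun _ => hA _) (fun _ => hN _) (fun _ => hAO _) (fun _ => hAN _)
      (fun _ => hNe _)
      (fun i j h => hskew _ _ (Fin.castSucc_lt_castSucc_iff.2 h))
      (fun j y hy => by
        obtain ⟨i, hi, hy⟩ := hO _ y hy
        exact ⟨i.castPred (hi.trans_le (Fin.le_last _)).ne,
          by simpa [Fin.lt_def] using hi, by simpa using hy⟩)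
      (fun i j h => hNN _ _ (Fin.castSucc_lt_castSucc_iff.2 h))
    have htc : ∀ z ∈ N (Fin.last m), t z = c := fun z hz => by
      rw [ht₀ z fun i hi => Finset.disjoint_left.1 (hNN _ _ (Fin.castSucc_lt_last i)) hi hz,
        if_pos hz]
    let T : ℝ → ℕ → ℝ := fun ε z => if z ∈ N (Fin.last m) then c + ε * z else t z
    have hT0 : T 0 = t := by
      ext z
      by_cases hz : z ∈ N (Fin.last m) <;> simp [T, hz, htc]
    have hTc : ∀ z, Continuous fun ε => T ε z := fun z => by
      by_cases hz : z ∈ N (Fin.last m) <;> simp only [T, hz, if_true, if_false] <;> fun_prop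
    let S : Fin (m + 1) → ℝ := Fin.snoc s c
    let M : ℝ → Matrix (Fin (m + 1)) (Fin (m + 1)) ℝ := fun ε =>
      .of fun i j => (∏ x ∈ A i, (S j - T ε x)) * ∏ y ∈ O j, ∏ x ∈ A i, (T ε y - T ε x)
    have hMc : Continuous fun ε => (M ε).det := by
      refine Continuous.matrix_det (continuous_matrix fun i j => ?_)
      simp only [M, Matrix.of_apply]
      fun_prop
    have hne' : ∀ i, ∀ y ∈ N i, ∀ x ∈ X, x ≠ y → ¬ (y ∈ N (Fin.last m) ∧ x ∈ N (Fin.last m)) →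
        t y ≠ t x := by
      intro i y hy x hx hxy hn
      by_cases hxU : ∃ k : Fin m, x ∈ N k.castSucc
      · obtain ⟨k, hk⟩ := hxU
        exact (hne k x hk y (hN _ hy) hxy.symm).symm
      induction i using Fin.lastCases with
      | cast i => exact hne i y hy x hx hxy
      | last =>
        push Not at hxU
        rw [htc y hy, ht₀ x hxU, if_neg fun h => hn ⟨hy, h⟩]
        rintro rfl
        exact hc (Finset.mem_image_of_mem _ hx)
    have hM0 : (M 0).det ≠ 0 := by
      have hcol : ∀ i, i ≠ Fin.last m → M 0 i (Fin.last m) = 0 := by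
        intro i hi
        obtain ⟨x, hx⟩ := hskew i _ (Fin.lt_last_iff_ne_last.2 hi)
        rw [Finset.mem_inter, Finset.mem_union] at hx
        simp only [M, Matrix.of_apply, hT0, S, Fin.snoc_last]
        rcases hx.2 with h | h
        · rw [Finset.prod_eq_zero h (Finset.prod_eq_zero hx.1 (sub_self _)), mul_zero]
        · rw [Finset.prod_eq_zero hx.1 (by rw [htc x h, sub_self]), zero_mul]
      rw [Matrix.det_succ_column _ (Fin.last m), Finset.sum_eq_single (Fin.last m)
        (fun i _ hi => by rw [hcol i hi]; ring) (by simp)]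
      refine mul_ne_zero (mul_ne_zero (by simp) ?_) ?_
      · simp only [M, Matrix.of_apply, hT0, S, Fin.snoc_last]
        refine mul_ne_zero (Finset.prod_ne_zero_iff.2 fun x hx => sub_ne_zero.2 ?_)
          (Finset.prod_ne_zero_iff.2 fun y hy => Finset.prod_ne_zero_iff.2 fun x hx =>
            sub_ne_zero.2 ?_)
        · have hxN := Finset.disjoint_left.1 (hAN _) hx
          by_cases hxU : ∃ k : Fin m, x ∈ N k.castSucc
          · obtain ⟨k, hk⟩ := hxU
            obtain ⟨z, hz⟩ := hNe (Fin.last m)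
            rw [← htc z hz]
            exact (hne k x hk z (hN _ hz) fun h => hxN (h ▸ hz)).symm
          · push Not at hxU
            rw [ht₀ x hxU, if_neg hxN]
            rintro rfl
            exact hc (Finset.mem_image_of_mem _ (hA _ hx))
        · obtain ⟨i, _, hy'⟩ := hO _ y hy
          refine hne' i y hy' x (hA _ hx) ?_ fun h => Finset.disjoint_left.1 (hAN _) hx h.2
          rintro rfl
          exact Finset.disjoint_left.1 (hAO _) hx hy
      · convert hdet using 2
        ext i j
        simp [M, S, hT0]
    have hev : ∀ᶠ ε in 𝓝[≠] (0 : ℝ), (M ε).det ≠ 0 ∧ ∀ y ∈ X, ∀ x ∈ X,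
        (∃ i, y ∈ N i) → x ≠ y → T ε y ≠ T ε x := by
      refine ((hMc.continuousAt.eventually_ne hM0).filter_mono nhdsWithin_le_nhds).and ?_
      simp only [Filter.eventually_all_finset, Filter.eventually_imp_distrib_left]
      rintro y - x hx ⟨i, hi⟩ hxy
      by_cases h : y ∈ N (Fin.last m) ∧ x ∈ N (Fin.last m)
      · filter_upwards [self_mem_nhdsWithin] with ε hε
        simpa [T, h.1, h.2, Set.mem_compl_singleton_iff.1 hε] using hxy.symm
      · have h0 : T 0 y ≠ T 0 x := by rw [hT0]; exact hne' i y hi x hx hxy h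
        exact ((hTc y).continuousAt.ne_iff_eventually_ne (hTc x).continuousAt |>.1 h0).filter_mono
          nhdsWithin_le_nhds
    obtain ⟨ε, hε, hε'⟩ := hev.exists
    refine ⟨T ε, S, fun y hy => ?_, fun i y hy x hx => hε' y (hN _ hy) x hx ⟨i, hy⟩, hε⟩
    simp [T, hy, ht₀ y fun i => hy _]

/-- If every `B j` contains an element outside the earlier `B i`, and at most `c` elements inside
them, then the length of a skew Bollobás system is at most `C(a + c + 1, a)`. -/
theorem IsSkewBollobasSystem.le_choose {m a c : ℕ} {A B : Fin m → Finset ℕ}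
    (h : IsSkewBollobasSystem m A B) (hA : ∀ i, (A i).card ≤ a)
    (hB : ∀ j, (B j ∩ (univ.filter (· < j)).biUnion B).card ≤ c)
    (hN : ∀ j, (B j \ (univ.filter (· < j)).biUnion B).Nonempty) :
    m ≤ (a + c + 1).choose a := by
  classical
  set P : Fin m → Finset ℕ := fun j => (univ.filter (· < j)).biUnion B with hP
  have hpad : ∀ i, ∃ A' : Finset ℕ, A i ⊆ A' ∧ A'.card = a ∧ Disjoint A' (B i) := by
    intro i
    obtain ⟨D, hD, hDc⟩ := (A i ∪ B i).finite_toSet.infinite_compl.exists_subset_card_eq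
      (a - (A i).card)
    have hD' : ∀ x ∈ D, x ∉ A i ∧ x ∉ B i := fun x hx => by simpa using hD hx
    refine ⟨A i ∪ D, Finset.subset_union_left, ?_, ?_⟩
    · rw [Finset.card_union_of_disjoint (Finset.disjoint_right.2 fun x hx => (hD' x hx).1), hDc]
      have := hA i
      lia
    · exact Finset.disjoint_union_left.2 ⟨h.1 i, Finset.disjoint_left.2 fun x hx => (hD' x hx).2⟩
  choose A' hAA' hA'c hA'B using hpad
  have hBmem : ∀ j, ∀ y ∈ B j, ∃ i ≤ j, y ∈ B i \ P i := by
    intro j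
    induction j using WellFoundedLT.induction with
    | ind j ih =>
      intro y hy
      by_cases hyP : y ∈ P j
      · simp only [hP, Finset.mem_biUnion, Finset.mem_filter, Finset.mem_univ, true_and] at hyP
        obtain ⟨k, hk, hyk⟩ := hyP
        obtain ⟨i, hi, hyi⟩ := ih k hk y hyk
        exact ⟨i, hi.trans hk.le, hyi⟩
      · exact ⟨j, le_rfl, Finset.mem_sdiff.2 ⟨hy, hyP⟩⟩
  obtain ⟨t, s, -, -, hdet⟩ := exists_points_det_ne_zero m A' (fun j => B j ∩ P j)
    (fun j => B j \ P j) (univ.biUnion A' ∪ univ.biUnion B) 0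
    (fun i => (Finset.subset_biUnion_of_mem A' (Finset.mem_univ i)).trans
      Finset.subset_union_left)
    (fun i => Finset.sdiff_subset.trans <|
      (Finset.subset_biUnion_of_mem B (Finset.mem_univ i)).trans Finset.subset_union_right)
    (fun i => (hA'B i).mono_right Finset.inter_subset_left)
    (fun i => (hA'B i).mono_right Finset.sdiff_subset) hN
    (fun i j hij => by
      rw [Finset.union_comm, Finset.sdiff_union_inter]
      exact (h.2 i j hij).mono (Finset.inter_subset_inter_right (hAA' i)))
    (fun j y hy => by
      simp only [hP, Finset.mem_inter, Finset.mem_biUnion, Finset.mem_filter, Finset.mem_univ,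
        true_and] at hy
      obtain ⟨-, k, hk, hyk⟩ := hy
      obtain ⟨i, hi, hyi⟩ := hBmem k y hyk
      exact ⟨i, hi.trans_lt hk, hyi⟩)
    (fun i j hij => Finset.disjoint_left.2 fun y hyi hyj => (Finset.mem_sdiff.1 hyj).2 <|
      Finset.mem_biUnion.2 ⟨i, by simpa using hij, (Finset.mem_sdiff.1 hyi).1⟩)
  let Q : Fin m → Polynomial ℝ := fun i => ∏ x ∈ A' i, (Polynomial.X - Polynomial.C (t x))
  have hQdeg : ∀ i, (Q i).natDegree = a := fun i => by
    rw [Polynomial.natDegree_finsetProd_X_sub_C_eq_card, hA'c]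
  have hQtop : ∀ i, (Q i).coeff a = 1 := fun i => by
    rw [← hQdeg i]
    exact Polynomial.monic_prod_of_monic _ _ fun x _ => Polynomial.monic_X_sub_C _
  have hQeval : ∀ i z, ∏ x ∈ A' i, (z - t x) = ∑ k : Fin (a + 1), (Q i).coeff k * z ^ (k : ℕ) := by
    intro i z
    rw [Fin.sum_univ_eq_sum_range fun k => (Q i).coeff k * z ^ k,
      ← Polynomial.eval_eq_sum_range' (by rw [hQdeg]; lia)]
    simp [Q, Polynomial.eval_prod]
  choose D hD hDc using fun j => Infinite.exists_superset_card_eq (B j ∩ P j) c (hB j)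
  let φ : Fin m → ℕ → Fin (a + 1) → ℝ := fun j y =>
    if y ∈ B j ∩ P j then fun k => t y ^ (k : ℕ) else Pi.single (Fin.last a) 1
  let l : Fin m → Fin (c + 1) → Fin (a + 1) → ℝ := fun j =>
    Fin.cons (fun k => s j ^ (k : ℕ)) fun r => φ j ((D j).equivFinOfCardEq (hDc j) |>.symm r)
  have key := card_le_of_det_prod_sum_ne_zero (fun i (k : Fin (a + 1)) => (Q i).coeff k) l (by
    convert hdet using 2
    ext i j
    simp only [Matrix.of_apply, Fin.prod_univ_succ, l, Fin.cons_zero, Fin.cons_succ]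
    rw [← hQeval, Equiv.prod_comp ((D j).equivFinOfCardEq (hDc j)).symm
      fun y : D j => ∑ k : Fin (a + 1), (Q i).coeff k * φ j y k,
      Finset.prod_coe_sort (D j) fun y => ∑ k : Fin (a + 1), (Q i).coeff k * φ j y k]
    congr 1
    rw [← Finset.prod_subset (hD j) fun y _ hy => by
      simp only [φ, if_neg hy, Pi.single_apply]
      simp [hQtop]]
    refine Finset.prod_congr rfl fun y hy => ?_
    rw [hQeval]
    simp only [φ, if_pos hy])
  rwa [show a + 1 + (c + 1) - 1 = a + c + 1 by lia,
    Nat.choose_symm_of_eq_add (show a + c + 1 = (c + 1) + a by lia)] at key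

theorem IsSkewBollobasSystem.comp {m r : ℕ} {A B : Fin m → Finset ℕ}
    (h : IsSkewBollobasSystem m A B) (e : Fin r ↪o Fin m) :
    IsSkewBollobasSystem r (A ∘ e) (B ∘ e) :=
  ⟨fun i => h.1 (e i), fun i j hij => h.2 (e i) (e j) (e.lt_iff_lt.2 hij)⟩

theorem sum_range_choose_add_one (a b : ℕ) :
    ∑ k ∈ range b, (a + (k + 1)).choose a = (a + b + 1).choose (a + 1) - 1 := by
  suffices ∑ k ∈ range b, (a + (k + 1)).choose a + 1 = (a + b + 1).choose (a + 1) by lia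
  induction b with
  | zero => simp
  | succ b ih =>
    rw [Finset.sum_range_succ, add_right_comm, ih, Nat.choose_succ_succ' (a + (b + 1)) a,
      add_comm]
    rfl

theorem IsSkewBollobasSystem.card_biUnion_le {m a b : ℕ} {A B : Fin m → Finset ℕ}
    (h : IsSkewBollobasSystem m A B) (hA : ∀ i, (A i).card ≤ a) (hB : ∀ i, (B i).card ≤ b) :
    (univ.biUnion B).card ≤ (a + b + 1).choose (a + 1) - 1 := by
  classical
  set P : Fin m → Finset ℕ := fun j => (univ.filter (· < j)).biUnion B with hP
  have hsub : univ.biUnion B ⊆ univ.biUnion fun j => B j \ P j := by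
    intro y hy
    simp only [Finset.mem_biUnion, Finset.mem_univ, true_and] at hy ⊢
    obtain ⟨j, hj, hmin⟩ := WellFounded.has_min (wellFounded_lt (α := Fin m)) {j | y ∈ B j} hy
    refine ⟨j, Finset.mem_sdiff.2 ⟨hj, fun hyP => ?_⟩⟩
    obtain ⟨k, hk, hyk⟩ := Finset.mem_biUnion.1 hyP
    exact hmin k hyk (by simpa using hk)
  have hlevel : ∀ k < b, (univ.filter fun j => b - k ≤ (B j \ P j).card).card ≤
      (a + (k + 1)).choose a := by
    intro k hk
    set I := univ.filter fun j => b - k ≤ (B j \ P j).card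
    let e := I.orderEmbOfFin rfl
    have he : ∀ i, b - k ≤ (B (e i) \ P (e i)).card := fun i =>
      (Finset.mem_filter.1 (I.orderEmbOfFin_mem rfl i)).2
    have hPe : ∀ j, (univ.filter (· < j)).biUnion (B ∘ e) ⊆ P (e j) := by
      intro j y hy
      obtain ⟨i, hi, hy⟩ := Finset.mem_biUnion.1 hy
      exact Finset.mem_biUnion.2 ⟨e i, by simpa using hi, hy⟩
    refine (h.comp e).le_choose (fun i => hA _) (fun j => ?_) fun j => ?_
    · refine (Finset.card_le_card (Finset.inter_subset_inter_left (hPe j))).trans ?_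
      have h1 := Finset.card_inter_add_card_sdiff (B (e j)) (P (e j))
      have h2 := hB (e j)
      have h3 := he j
      simp only [Function.comp_apply]
      lia
    · refine Finset.Nonempty.mono (Finset.sdiff_subset_sdiff subset_rfl (hPe j)) ?_
      exact Finset.card_pos.1 ((Nat.sub_pos_of_lt hk).trans_le (he j))
  calc (univ.biUnion B).card ≤ ∑ j, (B j \ P j).card :=
        (Finset.card_le_card hsub).trans Finset.card_biUnion_le
    _ = ∑ j, ((range b).filter fun k => b - k ≤ (B j \ P j).card).card := by
        refine Finset.sum_congr rfl fun j _ => ?_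
        have hj := (Finset.card_le_card (Finset.sdiff_subset (s := B j) (t := P j))).trans (hB j)
        rw [show ((range b).filter fun k => b - k ≤ (B j \ P j).card) =
          Finset.Ico (b - (B j \ P j).card) b by ext k; simp; lia, Nat.card_Ico]
        lia
    _ = ∑ k ∈ range b, (univ.filter fun j => b - k ≤ (B j \ P j).card).card :=
        Finset.sum_card_bipartiteAbove_eq_sum_card_bipartiteBelow _
    _ ≤ ∑ k ∈ range b, (a + (k + 1)).choose a :=
        Finset.sum_le_sum fun k hk => hlevel k (Finset.mem_range.1 hk)
    _ = _ := sum_range_choose_add_one a b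

theorem biUnion_fin_append {α : Type*} [DecidableEq α] {m n : ℕ} (F : Fin m → Finset α)
    (G : Fin n → Finset α) :
    univ.biUnion (Fin.append F G) = univ.biUnion F ∪ univ.biUnion G := by
  ext y
  rw [← not_iff_not]
  simp [Fin.forall_fin_add]

theorem exists_isSkewBollobasSystem_card_biUnion_eq (a b : ℕ) :
    ∃ (m : ℕ) (A B : Fin m → Finset ℕ), IsSkewBollobasSystem m A B ∧ 0 < m ∧
      (∀ i, (A i).card ≤ a) ∧ (∀ i, (B i).card ≤ b) ∧
      (univ.biUnion B).card + 1 = (a + b + 1).choose (a + 1) := by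
  induction a generalizing b with
  | zero =>
    refine ⟨1, fun _ => ∅, fun _ => range b, ⟨by simp, fun i j hij => ?_⟩, ?_⟩
    · exact absurd hij (by simp [Subsingleton.elim i j])
    · simp
  | succ a iha =>
    induction b with
    | zero =>
      refine ⟨1, fun _ => ∅, fun _ => ∅, ⟨by simp, fun i j hij => ?_⟩, ?_⟩
      · exact absurd hij (by simp [Subsingleton.elim i j])
      · simp
    | succ b ihb =>
      obtain ⟨m, A, B, h, -, hA, hB, hc⟩ := iha (b + 1)
      obtain ⟨n, A', B', h', hn, hA', hB', hc'⟩ := ihb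
      let f : ℕ ↪ ℕ := ⟨fun x => 2 * x + 1, fun x y hxy => by simpa using hxy⟩
      let g : ℕ ↪ ℕ := ⟨fun x => 2 * x + 2, fun x y hxy => by simpa using hxy⟩
      have hf0 : ∀ s : Finset ℕ, 0 ∉ s.map f := fun s => by simp [f]
      have hg0 : ∀ s : Finset ℕ, 0 ∉ s.map g := fun s => by simp [g]
      have hfg : ∀ s s' : Finset ℕ, Disjoint (s.map f) (s'.map g) := fun s s' => by
        simp only [Finset.disjoint_left, Finset.mem_map, f, g]
        rintro _ ⟨x, -, rfl⟩ ⟨y, -, hxy⟩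
        change 2 * y + 2 = 2 * x + 1 at hxy
        lia
      refine ⟨m + n, Fin.append (fun i => insert 0 ((A i).map f)) fun i => (A' i).map g,
        Fin.append (fun i => (B i).map f) fun i => insert 0 ((B' i).map g),
        ⟨?_, ?_⟩, by lia, ?_, ?_, ?_⟩
      · rw [Fin.forall_fin_add]
        simp only [Fin.append_left, Fin.append_right, Finset.disjoint_insert_left,
          Finset.disjoint_insert_right, Finset.disjoint_map]
        exact ⟨fun i => ⟨hf0 _, h.1 i⟩, fun i => ⟨hg0 _, h'.1 i⟩⟩
      · intro i j
        induction i using Fin.addCases <;> induction j using Fin.addCases <;>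
          simp only [Fin.append_left, Fin.append_right] <;> intro hij
        · rename_i i j
          refine Finset.Nonempty.mono (Finset.inter_subset_inter_right
            (Finset.subset_insert _ _)) ?_
          rw [← Finset.map_inter, Finset.map_nonempty]
          exact h.2 i j (Fin.lt_def.2 (Fin.lt_def.1 hij))
        · exact ⟨0, by simp⟩
        · simp only [Fin.lt_def, Fin.val_natAdd, Fin.val_castAdd] at hij
          lia
        · rename_i i j
          refine Finset.Nonempty.mono (Finset.inter_subset_inter_left
            (Finset.subset_insert _ _)) ?_
          rw [← Finset.map_inter, Finset.map_nonempty]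
          exact h'.2 i j (by simpa using hij)
      · rw [Fin.forall_fin_add]
        simpa [hf0] using ⟨hA, hA'⟩
      · rw [Fin.forall_fin_add]
        simpa [hg0] using ⟨hB, hB'⟩
      · have hU : univ.biUnion (Fin.append (fun i => (B i).map f)
            fun i => insert 0 ((B' i).map g)) =
            (univ.biUnion B).map f ∪ insert 0 ((univ.biUnion B').map g) := by
          have hn' : Nonempty (Fin n) := ⟨⟨0, hn⟩⟩
          rw [biUnion_fin_append]
          ext y
          simp only [Finset.mem_union, Finset.mem_biUnion, Finset.mem_univ, true_and,
            Finset.mem_insert, Finset.mem_map, exists_or, exists_const]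
          grind
        rw [hU, Finset.card_union_of_disjoint (Finset.disjoint_insert_right.2 ⟨hf0 _, hfg _ _⟩),
          Finset.card_insert_of_notMem (hg0 _), Finset.card_map, Finset.card_map]
        have := Nat.choose_succ_succ' (a + 1 + (b + 1)) (a + 1)
        rw [show a + (b + 1) + 1 = a + 1 + (b + 1) by lia] at hc
        rw [show a + 1 + b + 1 = a + 1 + (b + 1) by lia] at hc'
        lia

end Auxiliary


/-- `S₂(a,b) = C(a+b+1, a+1) - 1`: the number `C(a+b+1, a+1) - 1` is the greatest size of
`B 1 ∪ ⋯ ∪ B m` over all skew Bollobás systems with `|A i| ≤ a`, `|B i| ≤ b`. -/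
theorem S2_eq (a b : ℕ) :
    IsGreatest {n : ℕ | ∃ (m : ℕ) (A B : Fin m → Finset ℕ),
        IsSkewBollobasSystem m A B ∧ (∀ i, (A i).card ≤ a) ∧ (∀ i, (B i).card ≤ b) ∧
        (Finset.univ.biUnion B).card = n}
      ((a + b + 1).choose (a + 1) - 1) := by
  constructor
  · obtain ⟨m, A, B, h, -, hA, hB, hc⟩ := exists_isSkewBollobasSystem_card_biUnion_eq a b
    exact ⟨m, A, B, h, hA, hB, by lia⟩
  · rintro _ ⟨m, A, B, h, hA, hB, rfl⟩
    exact h.card_biUnion_le hA hB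
end

section
/- Let a and b be non-negative integers. There exists a skew Bollobás system (A_1,B_1),...,(A_m,B_m) (over some finite ground set of natural numbers) with |A_i| ≤ a and |B_i| ≤ b for every i ∈ {1,...,m} such that |A_1 ∪ A_2 ∪ ... ∪ A_m| = C(a+b+1, a) − 1, where C denotes the binomial coefficient. -/
/-- Two skew Bollobás systems on disjoint copies of their ground sets are concatenated after adding
a new element to every first component of the one and to every second component of the other. -/
theorem IsSkewBollobasSystem.exists_append {m n a b : ℕ} {A B : Fin m → Finset ℕ}
    {C D : Fin n → Finset ℕ} (hm : 0 < m) (hAB : IsSkewBollobasSystem m A B)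
    (hCD : IsSkewBollobasSystem n C D) (hA : ∀ i, (A i).card ≤ a) (hB : ∀ i, (B i).card ≤ b + 1)
    (hC : ∀ i, (C i).card ≤ a + 1) (hD : ∀ i, (D i).card ≤ b) :
    ∃ E F : Fin (m + n) → Finset ℕ,
      IsSkewBollobasSystem (m + n) E F ∧ (∀ i, (E i).card ≤ a + 1) ∧ (∀ i, (F i).card ≤ b + 1) ∧
      (Finset.univ.biUnion E).card =
        (Finset.univ.biUnion A).card + (Finset.univ.biUnion C).card + 1 := by
  let f : ℕ ↪ ℕ := ⟨fun x => 2 * x + 1, fun x y h => by simpa using h⟩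
  let g : ℕ ↪ ℕ := ⟨fun x => 2 * x + 2, fun x y h => by simpa using h⟩
  have hf (x : ℕ) : f x = 2 * x + 1 := rfl
  have hg (x : ℕ) : g x = 2 * x + 2 := rfl
  refine ⟨Fin.append (fun i => insert 0 ((A i).map f)) (fun i => (C i).map g),
    Fin.append (fun i => (B i).map f) (fun i => insert 0 ((D i).map g)), ⟨?_, ?_⟩, ?_, ?_, ?_⟩
  · intro i
    refine Fin.addCases (fun i => ?_) (fun i => ?_) i
    · simpa [hf] using hAB.1 i
    · simpa [hg] using hCD.1 i
  · intro i j
    refine Fin.addCases (fun i => ?_) (fun i => ?_) i <;>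
      refine Fin.addCases (fun j => ?_) (fun j => ?_) j <;> intro h
    · obtain ⟨x, hx⟩ := hAB.2 i j h
      rw [Finset.mem_inter] at hx
      exact ⟨f x, by simp [hx]⟩
    · exact ⟨0, by simp⟩
    · simp only [Fin.lt_def, Fin.val_natAdd, Fin.val_castAdd] at h
      omega
    · obtain ⟨x, hx⟩ := hCD.2 i j (by simpa using h)
      rw [Finset.mem_inter] at hx
      exact ⟨g x, by simp [hx]⟩
  · intro i
    refine Fin.addCases (fun i => ?_) (fun i => ?_) i
    · simpa [hf] using hA i
    · simpa using hC i
  · intro i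
    refine Fin.addCases (fun i => ?_) (fun i => ?_) i
    · simpa using hB i
    · simpa [hg] using hD i
  · have hunion : Finset.univ.biUnion
        (Fin.append (fun i => insert 0 ((A i).map f)) (fun i => (C i).map g)) =
        insert 0 ((Finset.univ.biUnion A).map f ∪ (Finset.univ.biUnion C).map g) := by
      ext x
      simp only [Finset.mem_biUnion, Finset.mem_univ, true_and, Finset.mem_insert,
        Finset.mem_union, Finset.mem_map]
      constructor
      · rintro ⟨i, hi⟩
        induction i using Fin.addCases with
        | left i =>
          simp only [Fin.append_left, Finset.mem_insert, Finset.mem_map] at hi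
          grind
        | right i =>
          simp only [Fin.append_right, Finset.mem_map] at hi
          grind
      · rintro (rfl | ⟨y, ⟨i, hi⟩, rfl⟩ | ⟨y, ⟨i, hi⟩, rfl⟩)
        · exact ⟨Fin.castAdd n ⟨0, hm⟩, by
            rw [Fin.append_left]
            exact Finset.mem_insert_self _ _⟩
        · exact ⟨Fin.castAdd n i, by simp [hi]⟩
        · exact ⟨Fin.natAdd m i, by simp [hi]⟩
    have hdisj : Disjoint ((Finset.univ.biUnion A).map f) ((Finset.univ.biUnion C).map g) := by
      simp only [Finset.disjoint_left, Finset.mem_map]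
      rintro _ ⟨x, -, rfl⟩ ⟨y, -, h⟩
      rw [hf, hg] at h
      omega
    rw [hunion, Finset.card_insert_of_notMem (by simp [hf, hg]),
      Finset.card_union_of_disjoint hdisj, Finset.card_map, Finset.card_map]

/-- The extremal system can be chosen nonempty. -/
theorem exists_pos_union_A_card_eq (a b : ℕ) :
    ∃ (m : ℕ) (A B : Fin m → Finset ℕ), 0 < m ∧
      IsSkewBollobasSystem m A B ∧ (∀ i, (A i).card ≤ a) ∧ (∀ i, (B i).card ≤ b) ∧
      (Finset.univ.biUnion A).card = (a + b + 1).choose a - 1 := by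
  induction a generalizing b with
  | zero => exact ⟨1, fun _ => ∅, fun _ => ∅, by simp [IsSkewBollobasSystem]⟩
  | succ a iha =>
    induction b with
    | zero =>
      exact ⟨1, fun _ => Finset.range (a + 1), fun _ => ∅, by simp [IsSkewBollobasSystem]⟩
    | succ b ihb =>
      obtain ⟨m, A, B, hm, hAB, hA, hB, hcard⟩ := iha (b + 1)
      obtain ⟨n, C, D, -, hCD, hC, hD, hcard'⟩ := ihb
      obtain ⟨E, F, hEF, hE, hF, hcard''⟩ := hAB.exists_append hm hCD hA hB hC hD
      refine ⟨m + n, E, F, by omega, hEF, hE, hF, ?_⟩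
      rw [hcard'', hcard, hcard', show a + 1 + (b + 1) + 1 = a + (b + 1) + 1 + 1 by ring,
        show a + 1 + b + 1 = a + (b + 1) + 1 by ring, Nat.choose_succ_succ' (a + (b + 1) + 1)]
      have h₁ : 0 < (a + (b + 1) + 1).choose a := Nat.choose_pos (by omega)
      have h₂ : 0 < (a + (b + 1) + 1).choose (a + 1) := Nat.choose_pos (by omega)
      omega

/-- Lower bound: there is a skew Bollobás system with `|A i| ≤ a`, `|B i| ≤ b` and
`|A 1 ∪ ⋯ ∪ A m| = C(a+b+1, a) - 1`. -/
theorem exists_union_A_card_eq (a b : ℕ) :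
    ∃ (m : ℕ) (A B : Fin m → Finset ℕ),
      IsSkewBollobasSystem m A B ∧ (∀ i, (A i).card ≤ a) ∧ (∀ i, (B i).card ≤ b) ∧
      (Finset.univ.biUnion A).card = (a + b + 1).choose a - 1 := by
  obtain ⟨m, A, B, -, h⟩ := exists_pos_union_A_card_eq a b
  exact ⟨m, A, B, h⟩
end

section
/- Let a and b be non-negative integers. There exists a skew Bollobás system (A_1,B_1),...,(A_m,B_m) (over some finite ground set of natural numbers) with |A_i| ≤ a and |B_i| ≤ b for every i ∈ {1,...,m} such that |B_1 ∪ B_2 ∪ ... ∪ B_m| = C(a+b+1, a+1) − 1, where C denotes the binomial coefficient. -/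
/-- Every finite set with `C(a+b+1, a+1) - 1` elements is the union of the second components of a
nonempty skew Bollobás system, given as a list, with set sizes at most `a` and `b`. -/
theorem exists_list_skewBollobas {α : Type*} [DecidableEq α] (a b : ℕ) (U : Finset α)
    (hU : U.card + 1 = (a + b + 1).choose (a + 1)) :
    ∃ l : List (Finset α × Finset α), l ≠ [] ∧
      (∀ p ∈ l, Disjoint p.1 p.2 ∧ p.1.card ≤ a ∧ p.2.card ≤ b ∧ p.1 ⊆ U ∧ p.2 ⊆ U) ∧
      l.Pairwise (fun p q => (p.1 ∩ q.2).Nonempty) ∧ ∀ x ∈ U, ∃ p ∈ l, x ∈ p.2 := by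
  induction a generalizing b U with
  | zero =>
    have hb : U.card ≤ b := by simp at hU; omega
    exact ⟨[(∅, U)], by simp, by simpa using hb, by simp, by simp⟩
  | succ a iha =>
    induction b generalizing U with
    | zero =>
      have h0 : U = ∅ := by simpa using hU
      exact ⟨[(∅, ∅)], by simp, by simp, by simp, by simp [h0]⟩
    | succ b ihb =>
      have hpascal : (a + 1 + (b + 1) + 1).choose (a + 1 + 1) =
          (a + (b + 1) + 1).choose (a + 1) + (a + 1 + b + 1).choose (a + 1 + 1) := by
        rw [Nat.choose_succ_succ, show a + 1 + (b + 1) = a + (b + 1) + 1 by omega,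
          show a + 1 + b + 1 = a + (b + 1) + 1 by omega]
      have h1 : 0 < (a + (b + 1) + 1).choose (a + 1) := Nat.choose_pos (by omega)
      have h2 : 0 < (a + 1 + b + 1).choose (a + 1 + 1) := Nat.choose_pos (by omega)
      obtain ⟨x, hx⟩ : U.Nonempty := Finset.card_pos.mp (by omega)
      have hcard := Finset.card_erase_add_one hx
      obtain ⟨V, hVU, hV⟩ := Finset.exists_subset_card_eq
        (s := U.erase x) (n := (a + (b + 1) + 1).choose (a + 1) - 1) (by omega)
      have hW := Finset.card_sdiff_add_card_eq_card hVU
      obtain ⟨l₁, -, hl₁, hp₁, hu₁⟩ := iha (b + 1) V (by omega)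
      obtain ⟨l₂, hne, hl₂, hp₂, hu₂⟩ := ihb (U.erase x \ V) (by omega)
      have hxV : x ∉ V := fun h => by simpa using hVU h
      have hxW : x ∉ U.erase x \ V := by simp
      have hVU' : V ⊆ U := hVU.trans (Finset.erase_subset _ _)
      have hWU : U.erase x \ V ⊆ U := Finset.sdiff_subset.trans (Finset.erase_subset _ _)
      refine ⟨l₁.map (fun p => (insert x p.1, p.2)) ++ l₂.map (fun p => (p.1, insert x p.2)),
        by simp [hne], ?_, ?_, ?_⟩
      · intro p hp
        rcases List.mem_append.mp hp with hp | hp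
        · obtain ⟨q, hq, rfl⟩ := List.mem_map.mp hp
          obtain ⟨hd, hA, hB, hAU, hBU⟩ := hl₁ q hq
          exact ⟨Finset.disjoint_insert_left.mpr ⟨fun h => hxV (hBU h), hd⟩,
            (Finset.card_insert_le _ _).trans (by omega), hB,
            Finset.insert_subset hx (hAU.trans hVU'), hBU.trans hVU'⟩
        · obtain ⟨q, hq, rfl⟩ := List.mem_map.mp hp
          obtain ⟨hd, hA, hB, hAU, hBU⟩ := hl₂ q hq
          exact ⟨Finset.disjoint_insert_right.mpr ⟨fun h => hxW (hAU h), hd⟩, hA,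
            (Finset.card_insert_le _ _).trans (by omega),
            hAU.trans hWU, Finset.insert_subset hx (hBU.trans hWU)⟩
      · refine List.pairwise_append.mpr ⟨List.pairwise_map.mpr (hp₁.imp fun h => ?_),
          List.pairwise_map.mpr (hp₂.imp fun h => ?_), ?_⟩
        · exact h.mono (Finset.inter_subset_inter_right (Finset.subset_insert _ _))
        · exact h.mono (Finset.inter_subset_inter_left (Finset.subset_insert _ _))
        · intro p hp q hq
          obtain ⟨p, -, rfl⟩ := List.mem_map.mp hp
          obtain ⟨q, -, rfl⟩ := List.mem_map.mp hq
          exact ⟨x, by simp⟩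
      · intro y hy
        by_cases hyx : y = x
        · obtain ⟨q, hq⟩ := List.exists_mem_of_ne_nil l₂ hne
          exact ⟨_, List.mem_append_right _ (List.mem_map_of_mem hq), by simp [hyx]⟩
        · by_cases hyV : y ∈ V
          · obtain ⟨q, hq, hyq⟩ := hu₁ y hyV
            exact ⟨_, List.mem_append_left _ (List.mem_map_of_mem hq), hyq⟩
          · obtain ⟨q, hq, hyq⟩ := hu₂ y (by simp [hyx, hy, hyV])
            exact ⟨_, List.mem_append_right _ (List.mem_map_of_mem hq),
              Finset.mem_insert_of_mem hyq⟩

/-- Lower bound: there is a skew Bollobás system with `|A i| ≤ a`, `|B i| ≤ b` and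
`|B 1 ∪ ⋯ ∪ B m| = C(a+b+1, a+1) - 1`. -/
theorem exists_union_B_card_eq (a b : ℕ) :
    ∃ (m : ℕ) (A B : Fin m → Finset ℕ),
      IsSkewBollobasSystem m A B ∧ (∀ i, (A i).card ≤ a) ∧ (∀ i, (B i).card ≤ b) ∧
      (Finset.univ.biUnion B).card = (a + b + 1).choose (a + 1) - 1 := by
  have hpos : 0 < (a + b + 1).choose (a + 1) := Nat.choose_pos (by omega)
  obtain ⟨l, -, hl, hp, hu⟩ := exists_list_skewBollobas a b
    (Finset.range ((a + b + 1).choose (a + 1) - 1)) (by rw [Finset.card_range]; omega)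
  have hmem (i : Fin l.length) := hl (l.get i) (List.get_mem l i)
  refine ⟨l.length, fun i => (l.get i).1, fun i => (l.get i).2,
    ⟨fun i => (hmem i).1, fun i j hij => List.pairwise_iff_get.mp hp i j hij⟩,
    fun i => (hmem i).2.1, fun i => (hmem i).2.2.1, ?_⟩
  have hunion : Finset.univ.biUnion (fun i => (l.get i).2) =
      Finset.range ((a + b + 1).choose (a + 1) - 1) := by
    refine Finset.Subset.antisymm
      (Finset.biUnion_subset.mpr fun i _ => (hmem i).2.2.2.2) fun x hx => ?_
    obtain ⟨p, hpl, hxp⟩ := hu x hx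
    obtain ⟨i, rfl⟩ := List.get_of_mem hpl
    exact Finset.mem_biUnion.mpr ⟨i, Finset.mem_univ i, hxp⟩
  rw [hunion, Finset.card_range]
end

section
/- Let a and b be non-negative integers and let (A_1,B_1),...,(A_m,B_m) be a skew Bollobás system of finite subsets of the natural numbers with |A_i| ≤ a and |B_i| ≤ b for every i ∈ {1,...,m}. Then there exists a skew Bollobás system (A'_1,B'_1),...,(A'_m,B'_m) of finite subsets of the natural numbers such that for every i ∈ {1,...,m}: A_i ⊆ A'_i, B_i ⊆ B'_i, |A'_i| = a, and |B'_i| = b. In particular, |A'_1 ∪ ... ∪ A'_m| ≥ |A_1 ∪ ... ∪ A_m|. -/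
/-- Two finite sets of naturals lying below `N` stay disjoint after each is enlarged by
an interval, provided both intervals lie above `N` and do not overlap. -/
theorem disjoint_union_Ico {s t : Finset ℕ} {N k l d : ℕ} (hst : Disjoint s t)
    (hs : ∀ x ∈ s, x < N) (ht : ∀ x ∈ t, x < N) (hk : k ≤ d) :
    Disjoint (s ∪ Finset.Ico N (N + k)) (t ∪ Finset.Ico (N + d) (N + d + l)) := by
  rw [Finset.disjoint_left] at hst ⊢
  intro x hx hx'
  simp only [Finset.mem_union, Finset.mem_Ico] at hx hx'
  grind

/-- Filling up a finite set of naturals below `N` with an interval starting at or above `N`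
attains any prescribed cardinality that is at least the original one. -/
theorem card_union_Ico {s : Finset ℕ} {N M c : ℕ} (hs : ∀ x ∈ s, x < N) (hNM : N ≤ M)
    (hc : s.card ≤ c) : (s ∪ Finset.Ico M (M + (c - s.card))).card = c := by
  rw [Finset.card_union_of_disjoint, Nat.card_Ico]
  · omega
  · rw [Finset.disjoint_left]
    intro x hx hx'
    have := hs x hx
    have := (Finset.mem_Ico.mp hx').1
    omega

/-- Any skew Bollobás system with `|A i| ≤ a`, `|B i| ≤ b` can be extended to a skew
Bollobás system with `|A' i| = a`, `|B' i| = b`, with `A i ⊆ A' i` and `B i ⊆ B' i`;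
in particular the union of the `A' i` is at least as large as the union of the `A i`. -/
theorem exists_saturated_extension (a b m : ℕ)
    (A B : Fin m → Finset ℕ) (hsys : IsSkewBollobasSystem m A B)
    (hA : ∀ i, (A i).card ≤ a) (hB : ∀ i, (B i).card ≤ b) :
    ∃ A' B' : Fin m → Finset ℕ,
      IsSkewBollobasSystem m A' B' ∧
      (∀ i, A i ⊆ A' i) ∧ (∀ i, B i ⊆ B' i) ∧
      (∀ i, (A' i).card = a) ∧ (∀ i, (B' i).card = b) ∧
      (Finset.univ.biUnion A).card ≤ (Finset.univ.biUnion A').card := by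
  obtain ⟨hdisj, hinter⟩ := hsys
  obtain ⟨N, hN⟩ : ∃ N, ∀ i, ∀ x ∈ A i ∪ B i, x < N := by
    refine ⟨(Finset.univ.biUnion fun i => A i ∪ B i).sup id + 1, fun i x hx => ?_⟩
    exact Nat.lt_succ_of_le
      (Finset.le_sup (f := id) (Finset.mem_biUnion.mpr ⟨i, Finset.mem_univ i, hx⟩))
  have hNA : ∀ i, ∀ x ∈ A i, x < N := fun i x hx => hN i x (Finset.mem_union_left _ hx)
  have hNB : ∀ i, ∀ x ∈ B i, x < N := fun i x hx => hN i x (Finset.mem_union_right _ hx)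
  refine ⟨fun i => A i ∪ Finset.Ico N (N + (a - (A i).card)),
    fun i => B i ∪ Finset.Ico (N + a) (N + a + (b - (B i).card)), ⟨fun i => ?_, fun i j hij => ?_⟩,
    fun i => Finset.subset_union_left, fun i => Finset.subset_union_left,
    fun i => card_union_Ico (hNA i) le_rfl (hA i),
    fun i => card_union_Ico (hNB i) (Nat.le_add_right N a) (hB i), ?_⟩
  · exact disjoint_union_Ico (hdisj i) (hNA i) (hNB i) (Nat.sub_le a _)
  · exact (hinter i j hij).mono
      (Finset.inter_subset_inter Finset.subset_union_left Finset.subset_union_left)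
  · exact Finset.card_le_card (Finset.biUnion_mono fun i _ => Finset.subset_union_left)
end
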